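/- Unfolding at prefix intervals: for all metric formulas φ, ψ over A and every n > 0, the following equivalences hold over strict timed HT-traces (writing [0,n] for [0,n+1) and [i,i] for [i,i+1)): ψ U_{[0,n]} φ ≡ φ ∨ (ψ ∧ ⋁_{i=1}^{n} ○_{[i,i]}(ψ U_{[0,n−i]} φ)); ψ R_{[0,n]} φ ≡ φ ∧ (ψ ∨ ⋀_{i=1}^{n} ○̂_{[i,i]}(ψ R_{[0,n−i]} φ)). -/

import Mathlib

/-- Metric formulas over an alphabet `A`.  Each temporal operator carries an
interval `[m, n)` with `m : ℕ` and `n : ℕ∞` (where `⊤` plays the role of `ω`). -/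
inductive MForm (A : Type) : Type where
  | bot  : MForm A
  | atom : A → MForm A
  | conj : MForm A → MForm A → MForm A
  | disj : MForm A → MForm A → MForm A
  | impl : MForm A → MForm A → MForm A
  | prev  : ℕ → ℕ∞ → MForm A → MForm A
  | since : ℕ → ℕ∞ → MForm A → MForm A → MForm A
  | trig  : ℕ → ℕ∞ → MForm A → MForm A → MForm A
  | next  : ℕ → ℕ∞ → MForm A → MForm A
  | untl  : ℕ → ℕ∞ → MForm A → MForm A → MForm A
  | rel   : ℕ → ℕ∞ → MForm A → MForm A → MForm A

/-- Membership of a duration `d` in the interval `[m, n)`. -/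
def inIntv (m : ℕ) (n : ℕ∞) (d : ℕ) : Prop := m ≤ d ∧ (d : ℕ∞) < n

/-- Satisfaction `(⟨H,T⟩,τ), k ⊨ φ` for a timed HT-trace of length `len`. -/
def sat {A : Type} : MForm A → (ℕ → Set A) → (ℕ → Set A) → (ℕ → ℕ) → ℕ∞ → ℕ → Prop
  | .bot, _, _, _, _, _ => False
  | .atom p, H, _, _, _, k => p ∈ H k
  | .conj φ ψ, H, T, τ, len, k => sat φ H T τ len k ∧ sat ψ H T τ len k
  | .disj φ ψ, H, T, τ, len, k => sat φ H T τ len k ∨ sat ψ H T τ len k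
  | .impl φ ψ, H, T, τ, len, k =>
      (¬ sat φ H T τ len k ∨ sat ψ H T τ len k) ∧
      (¬ sat φ T T τ len k ∨ sat ψ T T τ len k)
  | .prev m n φ, H, T, τ, len, k =>
      0 < k ∧ sat φ H T τ len (k-1) ∧ inIntv m n (τ k - τ (k-1))
  | .since m n φ ψ, H, T, τ, len, k =>
      ∃ j, j ≤ k ∧ inIntv m n (τ k - τ j) ∧ sat ψ H T τ len j ∧
        ∀ i, j < i → i ≤ k → sat φ H T τ len i
  | .trig m n φ ψ, H, T, τ, len, k =>
      ∀ j, j ≤ k → inIntv m n (τ k - τ j) →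
        (sat ψ H T τ len j ∨ ∃ i, j < i ∧ i ≤ k ∧ sat φ H T τ len i)
  | .next m n φ, H, T, τ, len, k =>
      (k : ℕ∞) + 1 < len ∧ sat φ H T τ len (k+1) ∧ inIntv m n (τ (k+1) - τ k)
  | .untl m n φ ψ, H, T, τ, len, k =>
      ∃ j, k ≤ j ∧ (j : ℕ∞) < len ∧ inIntv m n (τ j - τ k) ∧ sat ψ H T τ len j ∧
        ∀ i, k ≤ i → i < j → sat φ H T τ len i
  | .rel m n φ ψ, H, T, τ, len, k =>
      ∀ j, k ≤ j → (j : ℕ∞) < len → inIntv m n (τ j - τ k) →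
        (sat ψ H T τ len j ∨ ∃ i, k ≤ i ∧ i < j ∧ sat φ H T τ len i)

/-- `(⟨H,T⟩,τ)` is a timed HT-trace of length `len`. -/
def isTrace {A : Type} (H T : ℕ → Set A) (τ : ℕ → ℕ) (len : ℕ∞) : Prop :=
  (∀ i : ℕ, (i : ℕ∞) < len → H i ⊆ T i) ∧
  (∀ i : ℕ, (i : ℕ∞) + 1 < len → τ i ≤ τ (i+1)) ∧
  τ 0 = 0

/-- Strict timing. -/
def isStrict (τ : ℕ → ℕ) (len : ℕ∞) : Prop :=
  ∀ i : ℕ, (i : ℕ∞) + 1 < len → τ i < τ (i+1)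

/-- Negation `¬φ := φ → ⊥`. -/
def mNeg {A : Type} (φ : MForm A) : MForm A := MForm.impl φ MForm.bot

/-- `⊤ := ¬⊥`. -/
def mTop {A : Type} : MForm A := mNeg MForm.bot

/-- Eventually `◇_I φ := ⊤ U_I φ`. -/
def mEvent {A : Type} (m : ℕ) (n : ℕ∞) (φ : MForm A) : MForm A := MForm.untl m n mTop φ

/-- Always `◻_I φ := ⊥ R_I φ`. -/
def mAlways {A : Type} (m : ℕ) (n : ℕ∞) (φ : MForm A) : MForm A := MForm.rel m n MForm.bot φ

/-- Eventually-before `◆_I φ := ⊤ S_I φ`. -/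
def mEvB {A : Type} (m : ℕ) (n : ℕ∞) (φ : MForm A) : MForm A := MForm.since m n mTop φ

/-- Always-before `■_I φ := ⊥ T_I φ`. -/
def mAlwB {A : Type} (m : ℕ) (n : ℕ∞) (φ : MForm A) : MForm A := MForm.trig m n MForm.bot φ

/-- Weak next `○̂_I φ := ○_I φ ∨ ¬○_I ⊤`. -/
def mWNext {A : Type} (m : ℕ) (n : ℕ∞) (φ : MForm A) : MForm A :=
  MForm.disj (MForm.next m n φ) (mNeg (MForm.next m n mTop))

/-- Weak previous `•̂_I φ := •_I φ ∨ ¬•_I ⊤`. -/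
def mWPrev {A : Type} (m : ℕ) (n : ℕ∞) (φ : MForm A) : MForm A :=
  MForm.disj (MForm.prev m n φ) (mNeg (MForm.prev m n mTop))

/-- MHT-equivalence over strict timed HT-traces. -/
def mhtEquivStrict {A : Type} (φ ψ : MForm A) : Prop :=
  ∀ (H T : ℕ → Set A) (τ : ℕ → ℕ) (len : ℕ∞),
    isTrace H T τ len → isStrict τ len → ∀ k : ℕ, (k : ℕ∞) < len →
      (sat φ H T τ len k ↔ sat ψ H T τ len k)

/-- Finite disjunction of a list of formulas (`⊥` for the empty list). -/
def bigOr {A : Type} : List (MForm A) → MForm A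
  | [] => MForm.bot
  | f :: fs => MForm.disj f (bigOr fs)

/-- Finite conjunction of a list of formulas (`⊤` for the empty list). -/
def bigAnd {A : Type} : List (MForm A) → MForm A
  | [] => mTop
  | f :: fs => MForm.conj f (bigAnd fs)

theorem inIntv_prefix_iff (n d : ℕ) : inIntv 0 ((n : ℕ∞) + 1) d ↔ d ≤ n := by
  have h : ((d : ℕ∞) < (n : ℕ∞) + 1) ↔ d < n + 1 := by exact_mod_cast Iff.rfl
  simp only [inIntv, h]
  omega

theorem inIntv_point_iff (j d : ℕ) : inIntv (j + 1) ((j : ℕ∞) + 2) d ↔ d = j + 1 := by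
  have h : ((d : ℕ∞) < (j : ℕ∞) + 2) ↔ d < j + 2 := by exact_mod_cast Iff.rfl
  simp only [inIntv, h]
  omega

theorem natCast_add_one_lt_of_lt {k j : ℕ} {len : ℕ∞} (hkj : k < j) (hj : (j : ℕ∞) < len) :
    (k : ℕ∞) + 1 < len :=
  lt_of_le_of_lt (by exact_mod_cast hkj) hj

theorem isStrict.le_of_le {τ : ℕ → ℕ} {len : ℕ∞} (hs : isStrict τ len) {k j : ℕ} (hkj : k ≤ j)
    (hj : (j : ℕ∞) < len) : τ k ≤ τ j := by
  induction j, hkj using Nat.le_induction with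
  | base => exact le_rfl
  | succ j _ ih =>
    have hj' : (j : ℕ∞) + 1 < len := natCast_add_one_lt_of_lt (Nat.lt_succ_self j) hj
    exact (ih (lt_of_le_of_lt (by exact_mod_cast Nat.le_succ j) hj)).trans (hs j hj').le

section

variable {A : Type} {H T : ℕ → Set A} {τ : ℕ → ℕ} {len : ℕ∞} {k : ℕ}

theorem sat_bigOr_iff {l : List (MForm A)} :
    sat (bigOr l) H T τ len k ↔ ∃ f ∈ l, sat f H T τ len k := by
  induction l with
  | nil => simp [bigOr, sat]
  | cons f l ih => simp [bigOr, sat, ih]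

theorem sat_mTop : sat (mTop : MForm A) H T τ len k := by
  simp [mTop, mNeg, sat]

theorem sat_bigAnd_iff {l : List (MForm A)} :
    sat (bigAnd l) H T τ len k ↔ ∀ f ∈ l, sat f H T τ len k := by
  induction l with
  | nil => simp [bigAnd, sat_mTop]
  | cons f l ih => simp [bigAnd, sat, ih]

theorem sat_mWNext_iff {m : ℕ} {n : ℕ∞} {φ : MForm A} :
    sat (mWNext m n φ) H T τ len k ↔
      ((k : ℕ∞) + 1 < len → inIntv m n (τ (k + 1) - τ k) → sat φ H T τ len (k + 1)) := by
  have hH : sat (mTop : MForm A) H T τ len (k + 1) := sat_mTop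
  have hT : sat (mTop : MForm A) T T τ len (k + 1) := sat_mTop
  simp only [mWNext, mNeg, sat, hH, hT]
  tauto

/-- One-step unfolding of until at a prefix interval. -/
theorem sat_untl_prefix_iff (hs : isStrict τ len) (hk : (k : ℕ∞) < len) (φ ψ : MForm A) (n : ℕ) :
    sat (.untl 0 ((n : ℕ∞) + 1) ψ φ) H T τ len k ↔
      sat φ H T τ len k ∨ (sat ψ H T τ len k ∧ (k : ℕ∞) + 1 < len ∧ τ (k + 1) - τ k ≤ n ∧
        sat (.untl 0 (((n - (τ (k + 1) - τ k) : ℕ) : ℕ∞) + 1) ψ φ) H T τ len (k + 1)) := by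
  simp only [sat, inIntv_prefix_iff]
  constructor
  · rintro ⟨j, hkj, hj, hd, hφ, hψ⟩
    rcases hkj.eq_or_lt with rfl | hlt
    · exact .inl hφ
    · have hk1 := natCast_add_one_lt_of_lt hlt hj
      have h1 := hs k hk1
      have h2 : τ (k + 1) ≤ τ j := hs.le_of_le hlt hj
      exact .inr ⟨hψ k le_rfl hlt, hk1, by omega, j, hlt, hj, by omega, hφ,
        fun i hi hij => hψ i (by omega) hij⟩
  · rintro (hφ | ⟨hψk, hk1, hn, j, hkj, hj, hd, hφ, hψ⟩)
    · exact ⟨k, le_rfl, hk, by omega, hφ, fun i h1 h2 => by omega⟩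
    · refine ⟨j, by omega, hj, by omega, hφ, fun i hi hij => ?_⟩
      rcases hi.eq_or_lt with rfl | hlt
      · exact hψk
      · exact hψ i hlt hij

/-- One-step unfolding of release at a prefix interval. -/
theorem sat_rel_prefix_iff (hs : isStrict τ len) (hk : (k : ℕ∞) < len) (φ ψ : MForm A) (n : ℕ) :
    sat (.rel 0 ((n : ℕ∞) + 1) ψ φ) H T τ len k ↔
      sat φ H T τ len k ∧ (sat ψ H T τ len k ∨ ((k : ℕ∞) + 1 < len → τ (k + 1) - τ k ≤ n →
        sat (.rel 0 (((n - (τ (k + 1) - τ k) : ℕ) : ℕ∞) + 1) ψ φ) H T τ len (k + 1))) := by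
  simp only [sat, inIntv_prefix_iff]
  constructor
  · intro h
    refine ⟨(h k le_rfl hk (by omega)).resolve_right fun ⟨i, h1, h2, _⟩ => by omega,
      or_iff_not_imp_left.2 fun hψ _ _ j hkj hj hd => ?_⟩
    refine (h j (by omega) hj (by omega)).imp_right fun ⟨i, hi, hij, hψi⟩ => ?_
    rcases hi.eq_or_lt with rfl | hlt
    · exact absurd hψi hψ
    · exact ⟨i, hlt, hij, hψi⟩
  · rintro ⟨hφ, h⟩ j hkj hj hd
    rcases hkj.eq_or_lt with rfl | hlt
    · exact .inl hφ
    rcases h with hψ | h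
    · exact .inr ⟨k, le_rfl, hlt, hψ⟩
    have hk1 := natCast_add_one_lt_of_lt hlt hj
    have h1 := hs k hk1
    have h2 : τ (k + 1) ≤ τ j := hs.le_of_le hlt hj
    exact (h hk1 (by omega) j hlt hj (by omega)).imp_right
      fun ⟨i, hi, hij, hψi⟩ => ⟨i, by omega, hij, hψi⟩

end

/-- Unfolding at prefix intervals `[0,n] = [0,n+1)` (Lemma 3). -/
theorem prefix_unfolding {A : Type} (φ ψ : MForm A) (n : ℕ) (hn : 0 < n) :
    mhtEquivStrict (MForm.untl 0 ((n : ℕ∞) + 1) ψ φ)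
      (MForm.disj φ (MForm.conj ψ (bigOr ((List.range n).map (fun j =>
        MForm.next (j+1) ((j : ℕ∞) + 2)
          (MForm.untl 0 (((n - (j+1) : ℕ) : ℕ∞) + 1) ψ φ)))))) ∧
    mhtEquivStrict (MForm.rel 0 ((n : ℕ∞) + 1) ψ φ)
      (MForm.conj φ (MForm.disj ψ (bigAnd ((List.range n).map (fun j =>
        mWNext (j+1) ((j : ℕ∞) + 2)
          (MForm.rel 0 (((n - (j+1) : ℕ) : ℕ∞) + 1) ψ φ)))))) := by
  refine ⟨fun H T τ len _ hs k hk => ?_, fun H T τ len _ hs k hk => ?_⟩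
  · rw [sat_untl_prefix_iff hs hk, sat, sat, sat_bigOr_iff]
    refine or_congr_right (and_congr_right fun _ => ?_)
    simp only [List.mem_map, List.mem_range, exists_exists_and_eq_and]
    constructor
    · rintro ⟨hk1, hd, h⟩
      have h1 := hs k hk1
      have he : τ (k + 1) - τ k = τ (k + 1) - τ k - 1 + 1 := by omega
      refine ⟨τ (k + 1) - τ k - 1, by omega, hk1, ?_, (inIntv_point_iff _ _).2 he⟩
      rwa [← he]
    · rintro ⟨j, hj, hk1, h, hd⟩
      rw [inIntv_point_iff] at hd
      rw [hd]
      exact ⟨hk1, hj, h⟩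
  · rw [sat_rel_prefix_iff hs hk, sat, sat, sat_bigAnd_iff]
    refine and_congr_right fun _ => or_congr_right ?_
    simp only [List.mem_map, List.mem_range, forall_exists_index, and_imp,
      forall_apply_eq_imp_iff₂, sat_mWNext_iff, inIntv_point_iff]
    constructor
    · intro h j hj hk1 hd
      rw [hd] at h
      exact h hk1 hj
    · intro h hk1 hd
      have h1 := hs k hk1
      have he : τ (k + 1) - τ k = τ (k + 1) - τ k - 1 + 1 := by omega
      have := h (τ (k + 1) - τ k - 1) (by omega) hk1 he
      rwa [← he] at this
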